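/- arXiv:math/0508409 — 2 statements merged into one kernel-verified Lean document; each statement's English description precedes it below -/
import Mathlib

section
/- Let p be an odd prime and m ≥ 1 an integer with p ∤ m. Then [p]_{q^m} ≡ m·[p]_q/[m]_q (mod [p]_q^2). -/
open Polynomial Finset

/-- The indeterminate `q` as an element of the rational function field `ℚ(q)`. -/
noncomputable def q : RatFunc ℚ := algebraMap (Polynomial ℚ) (RatFunc ℚ) Polynomial.X

/-- The `q`-integer `[n]_a = 1 + a + ⋯ + a^(n-1)` with base `a ∈ ℚ(q)`. -/
noncomputable def qn (a : RatFunc ℚ) (n : ℕ) : RatFunc ℚ := ∑ i ∈ Finset.range n, a ^ i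

/-- The `q`-Pochhammer symbol `(x; a)_n = ∏_{i=0}^{n-1} (1 - x a^i)`. -/
noncomputable def qpoch (x a : RatFunc ℚ) (n : ℕ) : RatFunc ℚ :=
  ∏ i ∈ Finset.range n, (1 - x * a ^ i)

/-- The Gaussian binomial coefficient `[n choose k]_a = (a;a)_n / ((a;a)_k (a;a)_{n-k})`. -/
noncomputable def qbinom (a : RatFunc ℚ) (n k : ℕ) : RatFunc ℚ :=
  qpoch a a n / (qpoch a a k * qpoch a a (n - k))

/-- The polynomial `q`-integer `[n]_a = 1 + a + ⋯ + a^(n-1)` with base `a ∈ ℚ[q]`. -/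
noncomputable def pqn (a : Polynomial ℚ) (n : ℕ) : Polynomial ℚ := ∑ i ∈ Finset.range n, a ^ i

/-- `A ≡ B (mod g)`: the rational function `(A - B)/g`, written in lowest terms,
has denominator coprime to `g`. -/
def qCong (g : Polynomial ℚ) (A B : RatFunc ℚ) : Prop :=
  IsCoprime (((A - B) / algebraMap (Polynomial ℚ) (RatFunc ℚ) g).denom) g

/-- The `q`-Fermat quotient `Q_p(m, a) = ((a^m; a^m)_{p-1} / (a; a)_{p-1} - 1) / [p]_a`. -/
noncomputable def QF (p m : ℕ) (a : RatFunc ℚ) : RatFunc ℚ :=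
  (qpoch (a ^ m) (a ^ m) (p - 1) / qpoch a a (p - 1) - 1) / qn a p

/-- `⟨x⟩_p`: the least non-negative residue of the integer `x` modulo `p`. -/
def res (p : ℕ) (x : ℤ) : ℕ := (x % (p : ℤ)).toNat

/-- `R_p(m) = {j : 1 ≤ j < p/2, ⟨jm⟩_p > p/2}` (for odd `p`, `1 ≤ j < p/2` means
`1 ≤ j ≤ (p-1)/2`, and `⟨jm⟩_p > p/2` means `2⟨jm⟩_p > p`). -/
def Rset (p : ℕ) (m : ℤ) : Finset ℕ :=
  (Finset.Icc 1 ((p - 1) / 2)).filter fun j => p < 2 * res p ((j : ℤ) * m)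

theorem pqn_mul_sub_one (a : ℚ[X]) (n : ℕ) : pqn a n * (a - 1) = a ^ n - 1 :=
  geom_sum_mul a n

theorem algebraMap_pqn (a : ℚ[X]) (n : ℕ) :
    algebraMap ℚ[X] (RatFunc ℚ) (pqn a n) = qn (algebraMap ℚ[X] (RatFunc ℚ) a) n := by
  simp [pqn, qn]

theorem pqn_X_ne_zero {n : ℕ} (hn : n ≠ 0) : pqn X n ≠ 0 := by
  intro h
  have h1 := pqn_mul_sub_one X n
  rw [h, zero_mul] at h1
  exact X_pow_sub_C_ne_zero (Nat.pos_of_ne_zero hn) (1 : ℚ) (by simpa using h1.symm)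

theorem pqn_X_pow_mul_comm (m n : ℕ) :
    pqn (X ^ m) n * pqn X m = pqn X n * pqn (X ^ n) m := by
  have hX : (X - 1 : ℚ[X]) ≠ 0 := by simpa using X_sub_C_ne_zero (1 : ℚ)
  apply mul_right_cancel₀ hX
  calc pqn (X ^ m) n * pqn X m * (X - 1)
      = pqn (X ^ m) n * (X ^ m - 1) := by rw [mul_assoc, pqn_mul_sub_one]
    _ = pqn (X ^ n) m * (X ^ n - 1) := by
        rw [pqn_mul_sub_one, pqn_mul_sub_one, ← pow_mul, ← pow_mul, mul_comm]
    _ = pqn X n * pqn (X ^ n) m * (X - 1) := by rw [← pqn_mul_sub_one X n]; ring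

theorem sub_one_dvd_pqn_sub_natCast (a : ℚ[X]) (m : ℕ) : a - 1 ∣ pqn a m - (m : ℚ[X]) := by
  have h : pqn a m - (m : ℚ[X]) = ∑ i ∈ Finset.range m, (a ^ i - 1) := by simp [pqn]
  rw [h]
  exact Finset.dvd_sum fun i _ => sub_one_dvd_pow_sub_one a i

theorem isCoprime_pqn_X {p m : ℕ} (hp : p.Prime) (hpm : ¬ p ∣ m) :
    IsCoprime (pqn X p) (pqn X m) := by
  have : Fact p.Prime := ⟨hp⟩
  have hcyc : pqn X p = cyclotomic p ℚ := (cyclotomic_prime ℚ p).symm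
  rw [hcyc, (cyclotomic.irreducible_rat hp.pos).coprime_iff_not_dvd]
  intro hdvd
  have hζ := Complex.isPrimitiveRoot_exp p hp.ne_zero
  set ζ := Complex.exp (2 * Real.pi * Complex.I / p)
  have hroot : aeval ζ (cyclotomic p ℚ) = 0 := by
    rw [aeval_def, ← eval_map, map_cyclotomic]
    exact hζ.isRoot_cyclotomic hp.pos
  have hdvd' : cyclotomic p ℚ ∣ X ^ m - 1 :=
    pqn_mul_sub_one X m ▸ hdvd.mul_right _
  have h := aeval_eq_zero_of_dvd_aeval_eq_zero hdvd' hroot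
  refine hpm (hζ.dvd_of_pow_eq_one m (sub_eq_zero.mp ?_))
  simpa using h

theorem qn_pow_m_congruence (p : ℕ) (hp : p.Prime) (hodd : Odd p)
    (m : ℕ) (hm : 1 ≤ m) (hpm : ¬ p ∣ m) :
    qCong (pqn Polynomial.X p ^ 2)
      (qn (q ^ m) p) ((m : RatFunc ℚ) * qn q p / qn q m) := by
  have hm0 : m ≠ 0 := by lia
  obtain ⟨S, hS⟩ := sub_one_dvd_pqn_sub_natCast (X ^ p) m
  have key : pqn (X ^ m) p * pqn X m - (m : ℚ[X]) * pqn X p =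
      (X - 1) * S * pqn X p ^ 2 := by
    linear_combination pqn_X_pow_mul_comm m p + pqn X p * hS - pqn X p * S * pqn_mul_sub_one X p
  have hinj {f : ℚ[X]} :=
    map_ne_zero_iff (algebraMap ℚ[X] (RatFunc ℚ)) (RatFunc.algebraMap_injective ℚ) (x := f)
  have hp' := hinj.mpr (pqn_X_ne_zero hp.ne_zero)
  have hm' := hinj.mpr (pqn_X_ne_zero hm0)
  have keyR := congrArg (algebraMap ℚ[X] (RatFunc ℚ)) key
  have hquot : (qn (q ^ m) p - (m : RatFunc ℚ) * qn q p / qn q m) /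
      algebraMap ℚ[X] (RatFunc ℚ) (pqn X p ^ 2) =
      algebraMap ℚ[X] (RatFunc ℚ) ((X - 1) * S) / algebraMap ℚ[X] (RatFunc ℚ) (pqn X m) := by
    rw [q, ← map_pow, ← algebraMap_pqn, ← algebraMap_pqn, ← algebraMap_pqn,
      div_eq_div_iff (by simpa using hp') hm', ← map_mul, ← keyR, sub_mul, div_mul_cancel₀ _ hm']
    simp
  rw [qCong, hquot]
  exact ((isCoprime_pqn_X hp hpm).symm.of_isCoprime_of_dvd_left
    (RatFunc.denom_div_dvd _ _)).pow_right
end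

section
/- Let p ≥ 5 be a prime and m ≥ 2 an integer with p ∤ m. Then [mp]_{q^2} · Σ_{j=1}^{(p−1)/2} ⌊jm/p⌋·q^{2jm}/[jm]_{q^2} ≡ m·[p]_q·( EQ*_p(m,q) − Q_p(2,q) + Q_p(2,q^m)/[m]_q + |R_p(m)|·(1−q) ) (mod [p]_q^2). -/
open Polynomial Finset

/-- `EQ*_p(m,q) = ((m/p) q^(2Σ_{j∈R_p(m)}(p-⟨jm⟩_p)) (q^(2m);q^(2m))_{(p-1)/2} /
(q^2;q^2)_{(p-1)/2} - 1) / [p]_q`. -/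
noncomputable def EQstar (p : ℕ) [Fact p.Prime] (m : ℕ) : RatFunc ℚ :=
  ((legendreSym p m : RatFunc ℚ) *
      q ^ (2 * ∑ j ∈ Rset p (m : ℤ), (p - res p ((j : ℤ) * m))) *
      (qpoch (q ^ (2 * m)) (q ^ (2 * m)) ((p - 1) / 2) /
        qpoch (q ^ 2) (q ^ 2) ((p - 1) / 2)) - 1) / qn q p

/-- The localization of `ℚ[q]` at `[p]_q`, as a subring of `ℚ(q)`: the rational functions whose
denominator is coprime to `[p]_q`. -/
noncomputable def localRing (p : ℕ) : Subring (RatFunc ℚ) where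
  carrier := {f | IsCoprime f.denom (pqn X p)}
  mul_mem' {a b} ha hb := (IsCoprime.mul_left ha hb).of_isCoprime_of_dvd_left
    (RatFunc.denom_mul_dvd a b)
  one_mem' := by simpa using isCoprime_one_left
  add_mem' {a b} ha hb := (IsCoprime.mul_left ha hb).of_isCoprime_of_dvd_left
    (RatFunc.denom_add_dvd a b)
  zero_mem' := by simpa using isCoprime_one_left
  neg_mem' {a} ha := IsCoprime.of_isCoprime_of_dvd_left ha <|
    (RatFunc.denom_dvd a.denom_ne_zero).2 ⟨-a.num, by
      rw [map_neg, neg_div, RatFunc.num_div_denom]⟩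

theorem mem_localRing {p : ℕ} {f : RatFunc ℚ} :
    f ∈ localRing p ↔ IsCoprime f.denom (pqn X p) := Iff.rfl

theorem q_mem_localRing (p : ℕ) : q ∈ localRing p := by
  rw [mem_localRing, q, RatFunc.denom_algebraMap]
  exact isCoprime_one_left

theorem one_sub_q_pow_ne_zero {k : ℕ} (hk : k ≠ 0) : (1 - q ^ k : RatFunc ℚ) ≠ 0 := by
  intro h
  have h1 : algebraMap ℚ[X] (RatFunc ℚ) (X ^ k - 1) = 0 := by
    rw [map_sub, map_pow, map_one]
    change q ^ k - 1 = 0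
    linear_combination -h
  exact X_pow_sub_C_ne_zero (Nat.pos_of_ne_zero hk) (1 : ℚ)
    (by simpa using RatFunc.algebraMap_injective ℚ (h1.trans (map_zero _).symm))

theorem isCoprime_X_pow_sub_one {p : ℕ} [Fact p.Prime] {k : ℕ} (hk : ¬ p ∣ k) :
    IsCoprime (X ^ k - 1 : ℚ[X]) (pqn X p) := by
  have hk0 : 0 < k := Nat.pos_of_ne_zero (by rintro rfl; simp at hk)
  rw [pqn, ← cyclotomic_prime, ← prod_cyclotomic_eq_X_pow_sub_one hk0]
  refine IsCoprime.prod_left fun d hd => cyclotomic.isCoprime_rat ?_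
  rintro rfl
  exact hk (Nat.dvd_of_mem_divisors hd)

theorem inv_one_sub_q_pow_mem {p : ℕ} [Fact p.Prime] {k : ℕ} (hk : ¬ p ∣ k) :
    (1 - q ^ k)⁻¹ ∈ localRing p := by
  have hk0 : k ≠ 0 := by rintro rfl; simp at hk
  have h : (1 - q ^ k)⁻¹ =
      algebraMap ℚ[X] (RatFunc ℚ) (-1) / algebraMap ℚ[X] (RatFunc ℚ) (X ^ k - 1) := by
    have h1 := one_sub_q_pow_ne_zero hk0
    have h2 : q ^ k - 1 ≠ 0 := fun h => h1 (by linear_combination -h)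
    rw [map_sub, map_pow, map_one, map_neg, map_one]
    change _ = -1 / (q ^ k - 1)
    field_simp
    ring
  rw [mem_localRing, h]
  exact (isCoprime_X_pow_sub_one hk).of_isCoprime_of_dvd_left (RatFunc.denom_div_dvd _ _)

/-- Congruence modulo `1 - q^p` in `localRing p`. -/
def LocalCong (p : ℕ) (a b : RatFunc ℚ) : Prop := ∃ h ∈ localRing p, a - b = (1 - q ^ p) * h

namespace LocalCong

variable {p : ℕ} {a b c d : RatFunc ℚ}

theorem refl (a : RatFunc ℚ) : LocalCong p a a := ⟨0, zero_mem _, by ring⟩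

theorem symm (h : LocalCong p a b) : LocalCong p b a := by
  obtain ⟨x, hx, h⟩ := h
  exact ⟨-x, neg_mem hx, by linear_combination -h⟩

theorem trans (h : LocalCong p a b) (h' : LocalCong p b c) : LocalCong p a c := by
  obtain ⟨x, hx, h⟩ := h
  obtain ⟨y, hy, h'⟩ := h'
  exact ⟨x + y, add_mem hx hy, by linear_combination h + h'⟩

theorem add (h : LocalCong p a b) (h' : LocalCong p c d) : LocalCong p (a + c) (b + d) := by
  obtain ⟨x, hx, h⟩ := h
  obtain ⟨y, hy, h'⟩ := h'
  exact ⟨x + y, add_mem hx hy, by linear_combination h + h'⟩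

theorem neg (h : LocalCong p a b) : LocalCong p (-a) (-b) := by
  obtain ⟨x, hx, h⟩ := h
  exact ⟨-x, neg_mem hx, by linear_combination -h⟩

theorem sub (h : LocalCong p a b) (h' : LocalCong p c d) : LocalCong p (a - c) (b - d) := by
  simpa only [sub_eq_add_neg] using h.add h'.neg

theorem mul_left (hc : c ∈ localRing p) (h : LocalCong p a b) :
    LocalCong p (c * a) (c * b) := by
  obtain ⟨x, hx, h⟩ := h
  exact ⟨c * x, mul_mem hc hx, by linear_combination c * h⟩

theorem mul_right (hc : c ∈ localRing p) (h : LocalCong p a b) :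
    LocalCong p (a * c) (b * c) := by
  simpa only [mul_comm _ c] using h.mul_left hc

theorem sum {ι : Type*} {s : Finset ι} {f g : ι → RatFunc ℚ}
    (h : ∀ i ∈ s, LocalCong p (f i) (g i)) : LocalCong p (∑ i ∈ s, f i) (∑ i ∈ s, g i) := by
  classical
  induction s using Finset.induction_on with
  | empty => exact refl _
  | insert i s hi ih =>
    rw [sum_insert hi, sum_insert hi]
    exact (h i (mem_insert_self i s)).add (ih fun j hj => h j (mem_insert_of_mem hj))

end LocalCong

/-- `1 - q^(pk) = (1 - q^p) [k]_{q^p}`. -/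
theorem one_sub_q_pow_mul (p k : ℕ) : 1 - q ^ (p * k) = (1 - q ^ p) * qn (q ^ p) k := by
  rw [qn, mul_neg_geom_sum, pow_mul]

theorem qn_q_pow_mem (p n k : ℕ) : qn (q ^ n) k ∈ localRing p :=
  sum_mem fun _ _ => pow_mem (pow_mem (q_mem_localRing p) _) _

theorem localCong_qn (p k : ℕ) : LocalCong p (qn (q ^ p) k) k := by
  have h : LocalCong p (qn (q ^ p) k) (∑ _i ∈ range k, 1) := LocalCong.sum fun i _ =>
    ⟨-qn (q ^ p) i, neg_mem (qn_q_pow_mem _ _ _), by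
      have := one_sub_q_pow_mul p i
      rw [pow_mul] at this
      linear_combination -this⟩
  simpa using h

/-- First-order expansion of `∏ (1 + τ a_i)` when `τ` is divisible by `1 - q^p`. -/
theorem exists_prod_one_add_mul_eq {p : ℕ} {ι : Type*} (s : Finset ι) {a : ι → RatFunc ℚ}
    {τ c : RatFunc ℚ} (hτ : τ = (1 - q ^ p) * c) (hc : c ∈ localRing p)
    (ha : ∀ i ∈ s, a i ∈ localRing p) :
    ∃ S, LocalCong p S (∑ i ∈ s, a i) ∧ ∏ i ∈ s, (1 + τ * a i) = 1 + τ * S := by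
  classical
  induction s using Finset.induction_on with
  | empty => exact ⟨0, by simpa using LocalCong.refl 0, by simp⟩
  | insert i s hi ih =>
    obtain ⟨S, hS, h⟩ := ih fun j hj => ha j (mem_insert_of_mem hj)
    have hi' := ha i (mem_insert_self i s)
    have hsum : ∑ j ∈ s, a j ∈ localRing p :=
      sum_mem fun j hj => ha j (mem_insert_of_mem hj)
    have hmem : S ∈ localRing p := by
      obtain ⟨x, hx, hS⟩ := hS
      have h1 : S = ∑ j ∈ s, a j + (1 - q ^ p) * x := by linear_combination hS
      rw [h1]
      exact add_mem hsum (mul_mem (sub_mem (one_mem _) (pow_mem (q_mem_localRing p) _)) hx)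
    refine ⟨a i + S + τ * a i * S, ?_, ?_⟩
    · rw [sum_insert hi]
      obtain ⟨x, hx, hS⟩ := hS
      refine ⟨x + c * a i * S, add_mem hx (mul_mem (mul_mem hc hi') hmem), ?_⟩
      rw [hτ]
      linear_combination hS
    · rw [prod_insert hi, h]
      ring

/-- The fraction `q^k / (1 - q^k)`. -/
noncomputable def qfrac (k : ℕ) : RatFunc ℚ := q ^ k / (1 - q ^ k)

section qfrac

variable {p : ℕ} [Fact p.Prime] {k l : ℕ}

theorem qfrac_mem (hk : ¬ p ∣ k) : qfrac k ∈ localRing p := by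
  rw [qfrac, div_eq_mul_inv]
  exact mul_mem (pow_mem (q_mem_localRing p) _) (inv_one_sub_q_pow_mem hk)

theorem qfrac_congr_add (e : ℕ) (hk : ¬ p ∣ k) :
    LocalCong p (qfrac k) (qfrac (k + p * e)) := by
  have hl : ¬ p ∣ k + p * e := fun h => hk ((Nat.dvd_add_left (dvd_mul_right p e)).1 h)
  refine ⟨q ^ k * qn (q ^ p) e * (1 - q ^ k)⁻¹ * (1 - q ^ (k + p * e))⁻¹,
    mul_mem (mul_mem (mul_mem (pow_mem (q_mem_localRing p) _) (qn_q_pow_mem _ _ _))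
      (inv_one_sub_q_pow_mem hk)) (inv_one_sub_q_pow_mem hl), ?_⟩
  have h1 : 1 - q ^ k ≠ 0 := one_sub_q_pow_ne_zero (by rintro rfl; simp at hk)
  have h2 : 1 - q ^ (k + p * e) ≠ 0 := one_sub_q_pow_ne_zero (by intro h; simp [h] at hl)
  have h3 := one_sub_q_pow_mul p e
  rw [qfrac, qfrac]
  field_simp
  rw [pow_add]
  linear_combination q ^ k * h3

theorem qfrac_neg (hk : ¬ p ∣ k) (hkl : p ∣ k + l) :
    LocalCong p (qfrac k) (-1 - qfrac l) := by
  obtain ⟨e, he⟩ := hkl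
  have hl : ¬ p ∣ l := fun h => hk ((Nat.dvd_add_left h).1 ⟨e, he⟩)
  refine ⟨qn (q ^ p) e * (1 - q ^ k)⁻¹ * (1 - q ^ l)⁻¹,
    mul_mem (mul_mem (qn_q_pow_mem _ _ _)
      (inv_one_sub_q_pow_mem hk)) (inv_one_sub_q_pow_mem hl), ?_⟩
  have h1 : 1 - q ^ k ≠ 0 := one_sub_q_pow_ne_zero (by rintro rfl; simp at hk)
  have h2 : 1 - q ^ l ≠ 0 := one_sub_q_pow_ne_zero (by rintro rfl; simp at hl)
  have h3 := one_sub_q_pow_mul p e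
  rw [← he, pow_add] at h3
  rw [qfrac, qfrac]
  field_simp
  linear_combination h3

end qfrac

section reindex

variable {M : Type*} [CommMonoid M]

theorem prod_range_two_mul_eq_pairs (f : ℕ → M) (n : ℕ) :
    ∏ i ∈ range (2 * n), f i = ∏ i ∈ range n, (f i * f (2 * n - 1 - i)) := by
  rw [prod_mul_distrib, two_mul, prod_range_add, ← prod_range_reflect (fun i => f (n + i))]
  congr 1
  refine prod_congr rfl fun i hi => ?_
  rw [mem_range] at hi
  congr 1
  omega

theorem prod_range_two_mul_eq_even_odd (f : ℕ → M) (n : ℕ) :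
    ∏ i ∈ range (2 * n), f i = ∏ i ∈ range n, (f (2 * i + 1) * f (2 * n - 2 - 2 * i)) := by
  have h : ∏ i ∈ range (2 * n), f i = ∏ i ∈ range n, (f (2 * i + 1) * f (2 * i)) := by
    induction n with
    | zero => simp
    | succ n ih =>
      rw [prod_range_succ, ← ih, mul_add, mul_one, prod_range_succ, prod_range_succ, mul_assoc,
        mul_comm (f (2 * n))]
  rw [h, prod_mul_distrib, prod_mul_distrib, ← prod_range_reflect (fun i => f (2 * i))]
  congr 1
  refine prod_congr rfl fun i hi => ?_
  rw [mem_range] at hi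
  congr 1
  omega

end reindex

theorem prod_Icc_one_eq_prod_range {M : Type*} [CommMonoid M] (f : ℕ → M) (n : ℕ) :
    ∏ j ∈ Icc 1 n, f j = ∏ i ∈ range n, f (i + 1) := by
  induction n with
  | zero => simp
  | succ n ih => rw [prod_Icc_succ_top (by omega), ih, prod_range_succ]

theorem qpoch_self_q_pow (M n : ℕ) :
    qpoch (q ^ M) (q ^ M) n = ∏ i ∈ range n, (1 - q ^ (M * (i + 1))) :=
  prod_congr rfl fun i _ => by rw [← pow_succ', ← pow_mul]

theorem qn_q_pow_eq_div {M : ℕ} (hM : M ≠ 0) (n : ℕ) :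
    qn (q ^ M) n = (1 - q ^ (M * n)) / (1 - q ^ M) := by
  rw [eq_div_iff (one_sub_q_pow_ne_zero hM), one_sub_q_pow_mul, mul_comm]

/-- First-order expansion of the quotient of `q`-factorials in `Q_p(2, q^M)`. -/
theorem exists_qpoch_two_div_eq {p : ℕ} [Fact p.Prime] (hp2 : p ≠ 2) {M : ℕ} (hM : ¬ p ∣ M) :
    ∃ S, LocalCong p S (∑ j ∈ Icc 1 ((p - 1) / 2), (-1 - qfrac (2 * (j * M)))) ∧
      qpoch ((q ^ M) ^ 2) ((q ^ M) ^ 2) (p - 1) / qpoch (q ^ M) (q ^ M) (p - 1) =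
        1 + (1 - q ^ (p * M)) * S := by
  have hp : p.Prime := Fact.out
  obtain ⟨n, hn⟩ := hp.odd_of_ne_two hp2
  have hM0 : M ≠ 0 := by rintro rfl; simp at hM
  have h1 : p - 1 = 2 * n := by omega
  have h2 : (p - 1) / 2 = n := by omega
  have hdvd : ∀ i ∈ range n, ¬ p ∣ M * (2 * n - 2 - 2 * i + 1) := fun i hi h => by
    rw [mem_range] at hi
    rcases hp.dvd_mul.1 h with h | h
    · exact hM h
    · have := Nat.le_of_dvd (by omega) h
      omega
  obtain ⟨S, hS, hprod⟩ := exists_prod_one_add_mul_eq (range n)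
    (a := fun i => qfrac (M * (2 * n - 2 - 2 * i + 1))) (one_sub_q_pow_mul p M)
    (qn_q_pow_mem p p M) fun i hi => qfrac_mem (hdvd i hi)
  refine ⟨S, hS.trans ?_, ?_⟩
  · rw [h2]
    have h3 := prod_Icc_one_eq_prod_range
      (fun j => Multiplicative.ofAdd (-1 - qfrac (2 * (j * M)))) n
    rw [← ofAdd_sum, ← ofAdd_sum] at h3
    rw [Multiplicative.ofAdd.injective h3]
    refine LocalCong.sum fun i hi => qfrac_neg (hdvd i hi) ⟨M, ?_⟩
    rw [mem_range] at hi
    obtain ⟨k, rfl⟩ : ∃ k, n = i + 1 + k := ⟨n - (i + 1), by omega⟩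
    rw [hn, show 2 * (i + 1 + k) - 2 - 2 * i + 1 = 2 * k + 1 by omega]
    ring
  · rw [← hprod, ← pow_mul, qpoch_self_q_pow, qpoch_self_q_pow, h1, prod_range_two_mul_eq_pairs,
      prod_range_two_mul_eq_even_odd, ← prod_div_distrib]
    refine prod_congr rfl fun i hi => ?_
    have hne1 : 1 - q ^ (M * (2 * i + 1 + 1)) ≠ 0 :=
      one_sub_q_pow_ne_zero (mul_ne_zero hM0 (by omega))
    have hne2 : 1 - q ^ (M * (2 * n - 2 - 2 * i + 1)) ≠ 0 :=
      one_sub_q_pow_ne_zero (mul_ne_zero hM0 (by omega))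
    rw [mem_range] at hi
    have e1 : M * 2 * (i + 1) = M * (2 * i + 1 + 1) := by ring
    have e2 : M * 2 * (2 * n - 1 - i + 1) = M * (2 * n - 2 - 2 * i + 1) + p * M := by
      obtain ⟨k, rfl⟩ : ∃ k, n = i + 1 + k := ⟨n - (i + 1), by omega⟩
      rw [hn, show 2 * (i + 1 + k) - 2 - 2 * i + 1 = 2 * k + 1 by omega,
        show 2 * (i + 1 + k) - 1 - i + 1 = 2 * k + i + 2 by omega]
      ring
    rw [e1, e2, qfrac, pow_add]
    field_simp
    ring

theorem exists_QF_two_eq {p : ℕ} [Fact p.Prime] (hp2 : p ≠ 2) {M : ℕ} (hM : ¬ p ∣ M) :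
    ∃ S, LocalCong p S (∑ j ∈ Icc 1 ((p - 1) / 2), (-1 - qfrac (2 * (j * M)))) ∧
      QF p 2 (q ^ M) = S * (1 - q ^ M) := by
  obtain ⟨S, hS, h⟩ := exists_qpoch_two_div_eq hp2 hM
  have hM0 : M ≠ 0 := by rintro rfl; simp at hM
  refine ⟨S, hS, ?_⟩
  have h1 := one_sub_q_pow_ne_zero hM0
  have h2 := one_sub_q_pow_ne_zero (mul_ne_zero (NeZero.ne p) hM0)
  rw [QF, h, qn_q_pow_eq_div hM0, mul_comm M p]
  field_simp
  ring

theorem res_natCast_mul (p j m : ℕ) : res p ((j : ℤ) * (m : ℤ)) = j * m % p := by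
  rw [res]
  norm_cast

/-- The distance from `jm` to the nearest multiple of `p`. -/
def absRes (p m j : ℕ) : ℕ := if p < 2 * (j * m % p) then p - j * m % p else j * m % p

theorem mem_Rset {p m j : ℕ} (hj : j ∈ Icc 1 ((p - 1) / 2)) :
    j ∈ Rset p (m : ℤ) ↔ p < 2 * (j * m % p) := by
  rw [Rset, mem_filter, res_natCast_mul, and_iff_right hj]

theorem not_dvd_mul_of_mem_Icc {p m j : ℕ} [Fact p.Prime] (hpm : ¬ p ∣ m)
    (hj : j ∈ Icc 1 ((p - 1) / 2)) : ¬ p ∣ j * m := fun h => by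
  rw [mem_Icc] at hj
  rcases (Fact.out : p.Prime).dvd_mul.1 h with h | h
  · have := Nat.le_of_dvd (by omega) h
    omega
  · exact hpm h

theorem Icc_one_half_eq {p : ℕ} [Fact p.Prime] (hp2 : p ≠ 2) :
    Icc 1 ((p - 1) / 2) = Ico 1 (p / 2).succ := by
  obtain ⟨n, hn⟩ := (Fact.out : p.Prime).odd_of_ne_two hp2
  ext x
  rw [mem_Icc, mem_Ico]
  omega

theorem map_absRes_Icc {p m : ℕ} [Fact p.Prime] (hp2 : p ≠ 2) (hpm : ¬ p ∣ m) :
    (Icc 1 ((p - 1) / 2)).1.map (absRes p m) = (Icc 1 ((p - 1) / 2)).1 := by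
  have h := ZMod.Ico_map_valMinAbs_natAbs_eq_Ico_map_id p (m : ZMod p)
    (by rwa [Ne, ZMod.natCast_eq_zero_iff])
  rw [← Icc_one_half_eq hp2, Multiset.map_id'] at h
  conv_rhs => rw [← h]
  refine Multiset.map_congr rfl fun j _ => ?_
  have hlt := Nat.mod_lt (j * m) (NeZero.pos p)
  rw [ZMod.valMinAbs_def_pos, ← Nat.cast_mul, ZMod.val_natCast, mul_comm m j, absRes]
  split_ifs <;> omega

theorem legendreSym_eq_neg_one_pow_card_Rset {p m : ℕ} [Fact p.Prime] (hp2 : p ≠ 2)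
    (hpm : ¬ p ∣ m) : legendreSym p m = (-1) ^ #(Rset p (m : ℤ)) := by
  rw [ZMod.gauss_lemma hp2 (by rwa [Int.cast_natCast, Ne, ZMod.natCast_eq_zero_iff]), Rset,
    Icc_one_half_eq hp2]
  congr 2
  refine filter_congr fun j _ => ?_
  rw [res_natCast_mul, Int.cast_natCast, ← Nat.cast_mul, ZMod.val_natCast, mul_comm m j]
  obtain ⟨n, hn⟩ := (Fact.out : p.Prime).odd_of_ne_two hp2
  omega

theorem two_mul_absRes_add {p m j : ℕ} (h : ¬ p < 2 * (j * m % p)) :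
    2 * (j * m) = 2 * absRes p m j + p * (2 * (j * m / p)) := by
  have h1 := Nat.div_add_mod (j * m) p
  rw [absRes, if_neg h]
  have h2 : p * (2 * (j * m / p)) = 2 * (p * (j * m / p)) := by ring
  omega

section absRes

variable {p m j : ℕ} [Fact p.Prime]

theorem not_dvd_absRes (h : ¬ p ∣ j * m) : ¬ p ∣ absRes p m j := by
  have h0 : j * m % p ≠ 0 := fun h' => h (Nat.dvd_of_mod_eq_zero h')
  have hlt := Nat.mod_lt (j * m) (NeZero.pos p)
  intro h'
  rw [absRes] at h'
  split_ifs at h' <;> have := Nat.le_of_dvd (by omega) h' <;> omega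

theorem two_mul_add_two_mul_absRes (h : p < 2 * (j * m % p)) :
    2 * (j * m) + 2 * absRes p m j = p * (2 * (j * m / p + 1)) := by
  have h1 := Nat.div_add_mod (j * m) p
  have hlt := Nat.mod_lt (j * m) (NeZero.pos p)
  rw [absRes, if_pos h]
  have h2 : p * (2 * (j * m / p + 1)) = 2 * (p * (j * m / p)) + 2 * p := by ring
  omega

theorem not_dvd_two_mul (hp2 : p ≠ 2) {k : ℕ} (h : ¬ p ∣ k) : ¬ p ∣ 2 * k := fun h' => by
  rcases (Fact.out : p.Prime).dvd_mul.1 h' with h' | h'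
  · exact hp2 ((Nat.prime_dvd_prime_iff_eq Fact.out Nat.prime_two).1 h')
  · exact h h'

theorem qfrac_two_mul_absRes (hp2 : p ≠ 2) (h : ¬ p ∣ j * m) :
    LocalCong p (qfrac (2 * absRes p m j))
      (if p < 2 * (j * m % p) then -1 - qfrac (2 * (j * m)) else qfrac (2 * (j * m))) := by
  have ht := not_dvd_two_mul hp2 (not_dvd_absRes h)
  split_ifs with hR
  · exact qfrac_neg ht ⟨_, (add_comm _ _).trans (two_mul_add_two_mul_absRes hR)⟩
  · rw [two_mul_absRes_add hR]
    exact qfrac_congr_add _ ht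

/-- The factor `1 - q^(2jm)` compared with `1 - q^(2t)`, where `t` is the distance from `jm` to
the nearest multiple of `p`. -/
theorem exists_one_sub_q_pow_eq (hp2 : p ≠ 2) (h : ¬ p ∣ j * m) :
    ∃ a ∈ localRing p,
      LocalCong p a (qfrac (2 * (j * m)) *
        (2 * (j * m / p : ℕ) + if p < 2 * (j * m % p) then 2 else 0)) ∧
      (if p < 2 * (j * m % p) then -q ^ (2 * absRes p m j) else 1) *
          (1 - q ^ (2 * (j * m))) / (1 - q ^ (2 * absRes p m j)) = 1 + (1 - q ^ p) * a := by
  have ht := not_dvd_two_mul hp2 (not_dvd_absRes h)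
  have hN := qfrac_mem (not_dvd_two_mul hp2 h)
  have hw := qfrac_two_mul_absRes hp2 h
  have hne : 1 - q ^ (2 * absRes p m j) ≠ 0 :=
    one_sub_q_pow_ne_zero fun h0 => ht (h0 ▸ dvd_zero p)
  split_ifs at hw ⊢ with hR
  · refine ⟨(-1 - qfrac (2 * absRes p m j)) * qn (q ^ p) (2 * (j * m / p + 1)),
      mul_mem (sub_mem (neg_mem (one_mem _)) (qfrac_mem ht)) (qn_q_pow_mem _ _ _), ?_, ?_⟩
    · refine (LocalCong.mul_right (qn_q_pow_mem _ _ _) ((LocalCong.refl (-1)).sub hw)).trans ?_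
      have h1 := LocalCong.mul_left hN (localCong_qn p (2 * (j * m / p + 1)))
      push_cast at h1 ⊢
      convert h1 using 1 <;> ring
    · have h2 := one_sub_q_pow_mul p (2 * (j * m / p + 1))
      rw [← two_mul_add_two_mul_absRes hR, pow_add] at h2
      rw [qfrac]
      field_simp
      linear_combination -h2
  · refine ⟨qfrac (2 * absRes p m j) * qn (q ^ p) (2 * (j * m / p)),
      mul_mem (qfrac_mem ht) (qn_q_pow_mem _ _ _), ?_, ?_⟩
    · refine (LocalCong.mul_right (qn_q_pow_mem _ _ _) hw).trans ?_
      have h1 := LocalCong.mul_left hN (localCong_qn p (2 * (j * m / p)))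
      push_cast at h1 ⊢
      rwa [add_zero]
    · have h2 := one_sub_q_pow_mul p (2 * (j * m / p))
      have h3 : q ^ (2 * (j * m)) =
          q ^ (2 * absRes p m j) * q ^ (p * (2 * (j * m / p))) := by
        rw [← pow_add, ← two_mul_absRes_add hR]
      rw [qfrac, h3]
      field_simp
      linear_combination q ^ (2 * absRes p m j) * h2

end absRes

theorem exists_EQstar_eq {p : ℕ} [Fact p.Prime] (hp2 : p ≠ 2) {m : ℕ} (hpm : ¬ p ∣ m) :
    ∃ S, LocalCong p S (∑ j ∈ Icc 1 ((p - 1) / 2), qfrac (2 * (j * m)) *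
        (2 * (j * m / p : ℕ) + if p < 2 * (j * m % p) then 2 else 0)) ∧
      EQstar p m = S * (1 - q) := by
  have hfac := fun j (hj : j ∈ Icc 1 ((p - 1) / 2)) =>
    exists_one_sub_q_pow_eq hp2 (not_dvd_mul_of_mem_Icc hpm hj)
  choose! a ha hcong hprod using hfac
  obtain ⟨S, hS, h⟩ := exists_prod_one_add_mul_eq (Icc 1 ((p - 1) / 2))
    (mul_one (1 - q ^ p)).symm (one_mem _) ha
  refine ⟨S, hS.trans (LocalCong.sum hcong), ?_⟩
  have hR : Rset p (m : ℤ) = {j ∈ Icc 1 ((p - 1) / 2) | p < 2 * (j * m % p)} :=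
    filter_congr fun j _ => by rw [res_natCast_mul]
  have hsign : ∏ j ∈ Icc 1 ((p - 1) / 2),
      (if p < 2 * (j * m % p) then -q ^ (2 * absRes p m j) else 1) =
      (legendreSym p m : RatFunc ℚ) *
        q ^ (2 * ∑ j ∈ Rset p (m : ℤ), (p - res p ((j : ℤ) * m))) := by
    rw [prod_ite, prod_const_one, mul_one, ← hR, legendreSym_eq_neg_one_pow_card_Rset hp2 hpm,
      prod_neg, prod_pow_eq_pow_sum, mul_sum]
    push_cast
    congr 2
    refine sum_congr rfl fun j hj => ?_
    rw [hR, mem_filter] at hj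
    rw [absRes, if_pos hj.2, res_natCast_mul]
  have hnum : qpoch (q ^ (2 * m)) (q ^ (2 * m)) ((p - 1) / 2) =
      ∏ j ∈ Icc 1 ((p - 1) / 2), (1 - q ^ (2 * (j * m))) := by
    rw [qpoch_self_q_pow, prod_Icc_one_eq_prod_range]
    exact prod_congr rfl fun i _ => by ring
  have hden : qpoch (q ^ 2) (q ^ 2) ((p - 1) / 2) =
      ∏ j ∈ Icc 1 ((p - 1) / 2), (1 - q ^ (2 * absRes p m j)) := by
    have h1 := congrArg (fun s => (s.map fun j => 1 - q ^ (2 * j)).prod) (map_absRes_Icc hp2 hpm)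
    simp only [Multiset.map_map] at h1
    rw [qpoch_self_q_pow, ← prod_Icc_one_eq_prod_range fun j => 1 - q ^ (2 * j)]
    exact h1.symm
  have hq : 1 - q ^ 1 ≠ 0 := one_sub_q_pow_ne_zero one_ne_zero
  have hqp : 1 - q ^ p ≠ 0 := one_sub_q_pow_ne_zero (NeZero.ne p)
  have hqn := qn_q_pow_eq_div one_ne_zero p
  rw [pow_one] at hq
  rw [pow_one, one_mul] at hqn
  rw [EQstar, ← hsign, hnum, hden, ← mul_div_assoc, ← prod_mul_distrib, ← prod_div_distrib,
    prod_congr rfl hprod, h, hqn]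
  field_simp
  ring

theorem sum_qfrac_localCong {p : ℕ} [Fact p.Prime] (hp2 : p ≠ 2) {m : ℕ} (hpm : ¬ p ∣ m) :
    LocalCong p (∑ j ∈ Icc 1 ((p - 1) / 2), qfrac (2 * (j * 1)))
      (∑ j ∈ Icc 1 ((p - 1) / 2),
        if p < 2 * (j * m % p) then -1 - qfrac (2 * (j * m)) else qfrac (2 * (j * m))) := by
  have h1 := congrArg (fun s => (s.map fun j => qfrac (2 * (j * 1))).sum)
    (map_absRes_Icc hp2 hpm)
  simp only [Multiset.map_map] at h1
  rw [Finset.sum, ← h1]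
  refine LocalCong.sum fun j hj => ?_
  simpa using qfrac_two_mul_absRes hp2 (not_dvd_mul_of_mem_Icc hpm hj)

theorem weighted_sum_congruence (p : ℕ) [Fact p.Prime] (hp5 : 5 ≤ p)
    (m : ℕ) (hm : 2 ≤ m) (hpm : ¬ p ∣ m) :
    qCong (pqn Polynomial.X p ^ 2)
      (qn (q ^ 2) (m * p) *
        ∑ j ∈ Finset.Icc 1 ((p - 1) / 2),
          ((j * m / p : ℕ) : RatFunc ℚ) * q ^ (2 * j * m) / qn (q ^ 2) (j * m))
      ((m : RatFunc ℚ) * qn q p *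
        (EQstar p m - QF p 2 q + QF p 2 (q ^ m) / qn q m +
          ((Rset p (m : ℤ)).card : RatFunc ℚ) * (1 - q))) := by
  have hp2 : p ≠ 2 := by omega
  have hp0 : p ≠ 0 := by omega
  have hm0 : m ≠ 0 := by omega
  obtain ⟨E, hE, hE'⟩ := exists_EQstar_eq hp2 hpm
  obtain ⟨S, hS, hS'⟩ := exists_QF_two_eq hp2 (Fact.out : p.Prime).not_dvd_one
  obtain ⟨T, hT, hT'⟩ := exists_QF_two_eq hp2 hpm
  have hq : 1 - q ≠ 0 := by simpa using one_sub_q_pow_ne_zero one_ne_zero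
  have hqp := one_sub_q_pow_ne_zero hp0
  have hqm := one_sub_q_pow_ne_zero hm0
  have hq2 := one_sub_q_pow_ne_zero two_ne_zero
  have hqn : ∀ n, qn q n = (1 - q ^ n) / (1 - q) := fun n => by
    simpa using qn_q_pow_eq_div one_ne_zero n
  rw [pow_one] at hS'
  have hleft : qn (q ^ 2) (m * p) * ∑ j ∈ Finset.Icc 1 ((p - 1) / 2),
      ((j * m / p : ℕ) : RatFunc ℚ) * q ^ (2 * j * m) / qn (q ^ 2) (j * m) =
      (1 - q ^ p) * (qn (q ^ p) (2 * m) *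
        ∑ j ∈ Icc 1 ((p - 1) / 2), (j * m / p : ℕ) * qfrac (2 * (j * m))) := by
    rw [← mul_assoc, ← one_sub_q_pow_mul, mul_sum, mul_sum]
    refine sum_congr rfl fun j hj => ?_
    have hj0 : 2 * (j * m) ≠ 0 := by
      rw [mem_Icc] at hj
      exact mul_ne_zero two_ne_zero (mul_ne_zero (by omega) hm0)
    have h1 := one_sub_q_pow_ne_zero hj0
    rw [qn_q_pow_eq_div two_ne_zero, qn_q_pow_eq_div two_ne_zero, qfrac, mul_assoc 2 j m,
      show 2 * (m * p) = p * (2 * m) by ring]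
    field_simp
  have hright : (m : RatFunc ℚ) * qn q p * (EQstar p m - QF p 2 q + QF p 2 (q ^ m) / qn q m +
      ((Rset p (m : ℤ)).card : RatFunc ℚ) * (1 - q)) =
      (1 - q ^ p) * (m * (E - S + T + #(Rset p (m : ℤ)))) := by
    rw [hE', hS', hT', hqn, hqn]
    field_simp
  have hcard : (#(Rset p (m : ℤ)) : RatFunc ℚ) =
      ∑ j ∈ Icc 1 ((p - 1) / 2), if p < 2 * (j * m % p) then 1 else 0 := by
    rw [sum_boole, Rset]
    simp only [res_natCast_mul]
  have hcong : LocalCong p (qn (q ^ p) (2 * m) *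
        ∑ j ∈ Icc 1 ((p - 1) / 2), (j * m / p : ℕ) * qfrac (2 * (j * m)))
      (m * (E - S + T + #(Rset p (m : ℤ)))) := by
    have hmem : ∑ j ∈ Icc 1 ((p - 1) / 2), (j * m / p : ℕ) * qfrac (2 * (j * m)) ∈ localRing p :=
      sum_mem fun j hj => mul_mem (natCast_mem _ _)
        (qfrac_mem (not_dvd_two_mul hp2 (not_dvd_mul_of_mem_Icc hpm hj)))
    refine (LocalCong.mul_right hmem (localCong_qn p (2 * m))).trans ?_
    rw [Nat.cast_mul, Nat.cast_two, mul_comm (2 : RatFunc ℚ), mul_assoc]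
    refine LocalCong.mul_left (natCast_mem _ _) ?_
    have h1 := ((hE.sub hS).add hT).add (LocalCong.refl (#(Rset p (m : ℤ)) : RatFunc ℚ))
    refine LocalCong.trans ?_ h1.symm
    have h2 := (sum_qfrac_localCong hp2 hpm).symm
    obtain ⟨x, hx, h2⟩ := h2
    refine ⟨x, hx, ?_⟩
    rw [← h2, hcard, mul_sum]
    simp only [← sum_sub_distrib, ← sum_add_distrib]
    refine sum_congr rfl fun j _ => ?_
    split_ifs <;> ring
  obtain ⟨x, hx, h⟩ := hcong
  have hpqn : algebraMap ℚ[X] (RatFunc ℚ) (pqn X p) = (1 - q ^ p) / (1 - q) := by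
    rw [← hqn, pqn, qn, map_sum]
    simp only [map_pow, q]
  rw [qCong, hleft, hright, ← mul_sub, h, map_pow, hpqn]
  refine IsCoprime.pow_right (mem_localRing.1 ?_)
  have h3 : (1 - q ^ p) * ((1 - q ^ p) * x) / ((1 - q ^ p) / (1 - q)) ^ 2 = (1 - q) ^ 2 * x := by
    field_simp
  rw [h3]
  exact mul_mem (pow_mem (sub_mem (one_mem _) (q_mem_localRing p)) _) hx
end
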